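/- Let h : ℝ^d × (0,∞) → ℝ be smooth with h > 0, v : ℝ^d × (0,∞) → ℝ^d smooth with ∂_t h + div(h v) = 0, z : ℝ^d → ℝ a fixed smooth bathymetry, g > 0, λ̄ > 0 and ε > 0 constants, and Γ ∈ C²(ℝ; [0,∞)). Let η, ω : ℝ^d × (0,∞) → ℝ be smooth and suppose ∂_t(h η) + div(v h η) = h ω − (3/2) h v·∇z. Define s_ε := λ̄ g (h²/ε) Γ'(η/h) and tp_ε := −(1/3)(λ̄ g/ε) h² (η Γ'(η/h) − 2h Γ(η/h)). Then ∂_t((λ̄ g/(3ε)) h³ Γ(η/h)) + div((λ̄ g/(3ε)) h³ Γ(η/h) v) + tp_ε div v = (1/3) s_ε ω − (1/2) s_ε v·∇z. -/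

import Mathlib

noncomputable section
open scoped BigOperators

/-- Physical space `ℝ^d`. -/
abbrev Spc (d : ℕ) := EuclideanSpace ℝ (Fin d)
/-- Space-time `ℝ^d × ℝ` (time is the second component). -/
abbrev SpT (d : ℕ) := Spc d × ℝ

/-- Time derivative `∂_t f`. -/
noncomputable def dT {d : ℕ} (f : SpT d → ℝ) (p : SpT d) : ℝ :=
  deriv (fun t => f (p.1, t)) p.2

/-- `i`-th spatial partial derivative `∂_i f` of a space-time function. -/
noncomputable def dX {d : ℕ} (i : Fin d) (f : SpT d → ℝ) (p : SpT d) : ℝ :=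
  fderiv ℝ (fun x => f (x, p.2)) p.1 (EuclideanSpace.single i 1)

/-- `i`-th spatial partial derivative `∂_i z` of a time-independent function. -/
noncomputable def dZ {d : ℕ} (i : Fin d) (z : Spc d → ℝ) (x : Spc d) : ℝ :=
  fderiv ℝ z x (EuclideanSpace.single i 1)

/-- Divergence `div u = ∑_i ∂_i u_i` of a vector field. -/
noncomputable def divF {d : ℕ} (u : SpT d → Spc d) (p : SpT d) : ℝ :=
  ∑ i, dX i (fun q => u q i) p

/-- Divergence `div (f v) = ∑_i ∂_i (v_i f)` of a scalar multiple of a vector field. -/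
noncomputable def divSV {d : ℕ} (v : SpT d → Spc d) (f : SpT d → ℝ) (p : SpT d) : ℝ :=
  ∑ i, dX i (fun q => v q i * f q) p

/-- Advection term `v·∇f`. -/
noncomputable def adv {d : ℕ} (v : SpT d → Spc d) (f : SpT d → ℝ) (p : SpT d) : ℝ :=
  ∑ i, v p i * dX i f p

/-- `v·∇z` for the (time-independent) bathymetry `z`. -/
noncomputable def advZ {d : ℕ} (v : SpT d → Spc d) (z : Spc d → ℝ) (p : SpT d) : ℝ :=
  ∑ i, v p i * dZ i z p.1

/-- The time derivative is the full derivative in the direction `(0, 1)`. -/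
theorem dT_eq_fderiv {d : ℕ} {f : SpT d → ℝ} {p : SpT d} (hf : DifferentiableAt ℝ f p) :
    dT f p = fderiv ℝ f p (0, 1) := by
  have hline : HasDerivAt (fun t : ℝ => ((p.1, t) : SpT d)) (0, 1) p.2 :=
    (hasDerivAt_const p.2 p.1).prodMk (hasDerivAt_id p.2)
  exact (HasFDerivAt.comp_hasDerivAt p.2 (l := f) hf.hasFDerivAt hline).deriv

/-- The spatial partial derivative is the full derivative in the direction `(e_i, 0)`. -/
theorem dX_eq_fderiv {d : ℕ} {f : SpT d → ℝ} {p : SpT d} (i : Fin d)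
    (hf : DifferentiableAt ℝ f p) :
    dX i f p = fderiv ℝ f p (EuclideanSpace.single i 1, 0) := by
  have hslice : HasFDerivAt (fun x : Spc d => ((x, p.2) : SpT d))
      ((ContinuousLinearMap.id ℝ (Spc d)).prod 0) p.1 :=
    (hasFDerivAt_id p.1).prodMk (hasFDerivAt_const p.2 p.1)
  have hcomp := HasFDerivAt.comp p.1 (g := f) hf.hasFDerivAt hslice
  unfold dX
  change fderiv ℝ (f ∘ fun x => (x, p.2)) p.1 _ = _
  rw [hcomp.fderiv]
  simp

/-- The time derivative plus the advection term is the derivative in the direction `(v, 1)`. -/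
theorem dT_add_adv_eq_fderiv {d : ℕ} (v : SpT d → Spc d) {f : SpT d → ℝ} {p : SpT d}
    (hf : DifferentiableAt ℝ f p) :
    dT f p + adv v f p = fderiv ℝ f p (v p, 1) := by
  have hsum : ∑ i, v p i • ((EuclideanSpace.single i 1, 0) : SpT d) = (v p, 0) := by
    ext j
    · simp [Prod.fst_sum, Finset.sum_apply, Pi.single_apply]
    · simp [Prod.snd_sum]
  have hadv : adv v f p = fderiv ℝ f p (v p, 0) := by
    simp only [adv, dX_eq_fderiv _ hf, ← hsum, map_sum, map_smul, smul_eq_mul]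
  rw [dT_eq_fderiv hf, hadv, ← map_add]
  simp

/-- Product rule `div (f v) = v·∇f + f div v`. -/
theorem divSV_eq_adv_add {d : ℕ} {v : SpT d → Spc d} {f : SpT d → ℝ} {p : SpT d}
    (hv : DifferentiableAt ℝ v p) (hf : DifferentiableAt ℝ f p) :
    divSV v f p = adv v f p + f p * divF v p := by
  have hvi (i : Fin d) : DifferentiableAt ℝ (fun q => v q i) p :=
    (differentiableAt_euclidean.1 hv) i
  simp only [divSV, adv, divF, Finset.mul_sum, ← Finset.sum_add_distrib]
  refine Finset.sum_congr rfl fun i _ => ?_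
  rw [dX_eq_fderiv i ((hvi i).fun_mul hf), dX_eq_fderiv i hf, dX_eq_fderiv i (hvi i),
    fderiv_fun_mul (hvi i) hf]
  simp

/-- Conservative transport equals the material derivative plus `f div v`. -/
theorem dT_add_divSV {d : ℕ} {v : SpT d → Spc d} {f : SpT d → ℝ} {p : SpT d}
    (hv : DifferentiableAt ℝ v p) (hf : DifferentiableAt ℝ f p) :
    dT f p + divSV v f p = fderiv ℝ f p (v p, 1) + f p * divF v p := by
  rw [divSV_eq_adv_add hv hf, ← add_assoc, dT_add_adv_eq_fderiv v hf]

/-- Under mass conservation and the `q₁`-equation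
`∂_t(h η) + div(v h η) = h ω - (3/2) h v·∇z`, the relaxation energy
`(λ̄ g/(3ε)) h³ Γ(η/h)` satisfies
`∂_t(·) + div(· v) + tp_ε div v = (1/3) s_ε ω - (1/2) s_ε v·∇z`. -/
theorem sgn_relaxation_energy_identity
    {d : ℕ} (g lam ε : ℝ) (hg : 0 < g) (hlam : 0 < lam) (hε : 0 < ε)
    (h : SpT d → ℝ) (v : SpT d → Spc d) (z : Spc d → ℝ)
    (hsm : ContDiff ℝ (⊤ : ℕ∞) h) (vsm : ContDiff ℝ (⊤ : ℕ∞) v) (zsm : ContDiff ℝ (⊤ : ℕ∞) z)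
    (hpos : ∀ p : SpT d, 0 < h p)
    (mass : ∀ p : SpT d, 0 < p.2 → dT h p + divSV v h p = 0)
    (Γ : ℝ → ℝ) (hΓsm : ContDiff ℝ 2 Γ) (hΓnonneg : ∀ x, 0 ≤ Γ x)
    (η ω : SpT d → ℝ) (ηsm : ContDiff ℝ (⊤ : ℕ∞) η) (ωsm : ContDiff ℝ (⊤ : ℕ∞) ω)
    (hyp : ∀ p : SpT d, 0 < p.2 →
      dT (fun q => h q * η q) p + divSV v (fun q => h q * η q) p
        = h p * ω p - (3/2) * h p * advZ v z p)
    (sε : SpT d → ℝ)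
    (hsε : ∀ p, sε p = lam * g * ((h p)^2 / ε) * deriv Γ (η p / h p))
    (tpε : SpT d → ℝ)
    (htpε : ∀ p, tpε p = -(1/3) * (lam * g / ε) * (h p)^2
        * (η p * deriv Γ (η p / h p) - 2 * h p * Γ (η p / h p))) :
    ∀ p : SpT d, 0 < p.2 →
      dT (fun q => (lam * g / (3 * ε)) * (h q)^3 * Γ (η q / h q)) p
        + divSV v (fun q => (lam * g / (3 * ε)) * (h q)^3 * Γ (η q / h q)) p
        + tpε p * divF v p
      = (1/3) * sε p * ω p - (1/2) * sε p * advZ v z p := by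
  intro p hp
  have hh : DifferentiableAt ℝ h p := hsm.differentiable (by simp) p
  have hv : DifferentiableAt ℝ v p := vsm.differentiable (by simp) p
  have hη : DifferentiableAt ℝ η p := ηsm.differentiable (by simp) p
  have hΓ : DifferentiableAt ℝ Γ (η p / h p) := hΓsm.differentiable (by simp) _
  have hp0 : h p ≠ 0 := (hpos p).ne'
  have hmass := mass p hp
  have hrelax := hyp p hp
  rw [dT_add_divSV hv hh] at hmass
  rw [dT_add_divSV hv (hh.fun_mul hη), fderiv_fun_mul hh hη] at hrelax
  have hquot : HasFDerivAt (fun q => η q / h q)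
      (η p • (-(h p ^ 2)⁻¹ • fderiv ℝ h p) + (h p)⁻¹ • fderiv ℝ η p) p := by
    simpa only [div_eq_mul_inv, Function.comp_apply] using
      hη.hasFDerivAt.fun_mul ((hasDerivAt_inv hp0).comp_hasFDerivAt p hh.hasFDerivAt)
  have henergy := ((hh.hasFDerivAt.pow 3).const_mul (lam * g / (3 * ε))).fun_mul
    (hΓ.hasDerivAt.comp_hasFDerivAt p hquot)
  simp only [Function.comp_apply] at henergy
  rw [dT_add_divSV hv henergy.differentiableAt, henergy.fderiv, hsε, htpε]
  simp only [add_apply, smul_apply, smul_eq_mul, nsmul_eq_mul] at hrelax ⊢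
  have hDh : fderiv ℝ h p (v p, 1) = -(h p * divF v p) := by linarith
  have hDη : fderiv ℝ η p (v p, 1) = ω p - 3 / 2 * advZ v z p := by
    apply mul_left_cancel₀ hp0
    rw [hDh] at hrelax
    linarith
  rw [hDh, hDη]
  field_simp
  push_cast
  ring
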